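/- Let n ≤ d be positive integers and let G be a graph on d+2 vertices that has a spherical representation in ℝ^d. Then G is representable in ℝ^n (and the representation is spherical) if and only if the multiplicity of λ₂ as an eigenvalue of the adjacency matrix A_G, diminished by one if λ₁ = λ₂, is at least d+1−n. -/

import Mathlib

open Matrix Finset
open scoped Classical

noncomputable section

/-- `p` realizes the graph `G` as a 2-distance set in `ℝ^d` with distance ratio `k`:
the larger distance `α₁` occurs exactly between adjacent vertices, the smaller
distance `α₂` between distinct non-adjacent vertices, both distances occur,
and `k = α₁ / α₂`. -/
def IsTwoDistRep (n d : ℕ) (G : SimpleGraph (Fin n)) (k : ℝ)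
    (p : Fin n → EuclideanSpace ℝ (Fin d)) : Prop :=
  ∃ α₁ α₂ : ℝ, α₂ < α₁ ∧ 0 < α₂ ∧ k = α₁ / α₂ ∧
    (∀ i j : Fin n, G.Adj i j → dist (p i) (p j) = α₁) ∧
    (∀ i j : Fin n, i ≠ j → ¬ G.Adj i j → dist (p i) (p j) = α₂) ∧
    (∃ i j : Fin n, G.Adj i j) ∧ (∃ i j : Fin n, i ≠ j ∧ ¬ G.Adj i j)

/-- `G` (a graph on `n` vertices) is representable in `ℝ^d` with ratio `k`. -/
def RepresentableWith (n d : ℕ) (G : SimpleGraph (Fin n)) (k : ℝ) : Prop :=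
  ∃ p : Fin n → EuclideanSpace ℝ (Fin d), IsTwoDistRep n d G k p

/-- `G` has a spherical representation in `ℝ^d` with ratio `k`. -/
def SphericalWith (n d : ℕ) (G : SimpleGraph (Fin n)) (k : ℝ) : Prop :=
  ∃ (p : Fin n → EuclideanSpace ℝ (Fin d)) (c : EuclideanSpace ℝ (Fin d)) (r : ℝ),
    IsTwoDistRep n d G k p ∧ ∀ i, dist (p i) c = r

/-- `G` has a spherical representation in `ℝ^d` (for some ratio). -/
def Spherical (n d : ℕ) (G : SimpleGraph (Fin n)) : Prop :=
  ∃ k : ℝ, SphericalWith n d G k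

/-- `G` is a complete multipartite graph: vertices can be classified so that two
vertices are adjacent exactly when they lie in different classes. -/
def IsCompleteMultipartite {n : ℕ} (G : SimpleGraph (Fin n)) : Prop :=
  ∃ f : Fin n → Fin n, ∀ i j : Fin n, G.Adj i j ↔ f i ≠ f j

/-- The matrix `B_G(k)`: zero diagonal, `-k²` at adjacent pairs, `-1` at
distinct non-adjacent pairs. -/
def BG {n : ℕ} (G : SimpleGraph (Fin n)) [DecidableRel G.Adj] (k : ℝ) :
    Matrix (Fin n) (Fin n) ℝ :=
  Matrix.of fun i j => if i = j then 0 else if G.Adj i j then -k ^ 2 else -1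

/-- The all-ones matrix `J`. -/
def Jmat (n : ℕ) : Matrix (Fin n) (Fin n) ℝ := Matrix.of fun _ _ => 1

/-- The orthogonal complement `𝟙^⊥` of the all-ones vector in `ℝ^n`. -/
def onePerp (n : ℕ) : Submodule ℝ (Fin n → ℝ) :=
  LinearMap.ker ((∑ i : Fin n, LinearMap.proj i : (Fin n → ℝ) →ₗ[ℝ] ℝ))

end

/-- The eigenspace of `A` for `t`, as a kernel. -/
def eigK {N : ℕ} (A : Matrix (Fin N) (Fin N) ℝ) (t : ℝ) : Submodule ℝ (Fin N → ℝ) :=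
  LinearMap.ker ((A - t • (1 : Matrix (Fin N) (Fin N) ℝ)).mulVecLin)

lemma mem_eigK {N : ℕ} (A : Matrix (Fin N) (Fin N) ℝ) (t : ℝ) (x : Fin N → ℝ) :
    x ∈ eigK A t ↔ A *ᵥ x = t • x := by
  simp [eigK, Matrix.sub_mulVec, sub_eq_zero, Matrix.smul_mulVec]

lemma mem_onePerp {N : ℕ} (x : Fin N → ℝ) : x ∈ onePerp N ↔ ∑ i, x i = 0 := by
  simp [onePerp]

lemma finrank_eigK {N : ℕ} (A : Matrix (Fin N) (Fin N) ℝ) (hA : A.IsHermitian) (t : ℝ) :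
    Module.finrank ℝ (eigK A t) = (Finset.univ.filter fun i => hA.eigenvalues i = t).card := by
  have h1 : (A - t • (1 : Matrix (Fin N) (Fin N) ℝ)).rank
      = (diagonal (fun i => hA.eigenvalues i - t)).rank := by
    have : A - t • (1 : Matrix (Fin N) (Fin N) ℝ) =
        (hA.eigenvectorUnitary : Matrix (Fin N) (Fin N) ℝ) *
          diagonal (fun i => hA.eigenvalues i - t) *
          star (hA.eigenvectorUnitary : Matrix (Fin N) (Fin N) ℝ) := by
      have e : diagonal (fun i => hA.eigenvalues i - t)
          = diagonal (RCLike.ofReal ∘ hA.eigenvalues) - t • (1 : Matrix (Fin N) (Fin N) ℝ) := by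
        ext i j
        by_cases h : i = j
        · subst h; simp
        · simp [h]
      have h2 := hA.spectral_theorem
      rw [Unitary.conjStarAlgAut_apply] at h2
      rw [e, Matrix.mul_sub, Matrix.sub_mul, ← h2]
      simp
    rw [this, ← Unitary.coe_star]
    rw [rank_mul_eq_left_of_isUnit_det _ _ (UnitaryGroup.det_isUnit _),
      rank_mul_eq_right_of_isUnit_det _ _ (UnitaryGroup.det_isUnit _)]
  rw [rank_diagonal] at h1
  have h3 := LinearMap.finrank_range_add_finrank_ker
    ((A - t • (1 : Matrix (Fin N) (Fin N) ℝ)).mulVecLin)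
  rw [← Matrix.rank, h1, Fintype.card_subtype, Module.finrank_fin_fun] at h3
  have h4 := Finset.card_filter_add_card_filter_not (s := (Finset.univ : Finset (Fin N)))
    (fun i => hA.eigenvalues i - t ≠ 0)
  simp only [not_not, sub_eq_zero, Finset.card_univ, Fintype.card_fin] at h4
  simp only [ne_eq, sub_eq_zero] at h3 h4
  unfold eigK
  omega

lemma dot_self_pos {N : ℕ} {x : Fin N → ℝ} (h : x ≠ 0) : 0 < x ⬝ᵥ x := by
  have h1 : 0 ≤ x ⬝ᵥ x := by
    simp only [dotProduct]; exact Finset.sum_nonneg fun i _ => mul_self_nonneg _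
  rcases h1.lt_or_eq with h2 | h2
  · exact h2
  · exact absurd (dotProduct_self_eq_zero.1 h2.symm) h

lemma psd_eig {N : ℕ} (A : Matrix (Fin N) (Fin N) ℝ) (hs : Aᵀ = A) (c t : ℝ)
    (h : ∀ x : Fin N → ℝ, 0 ≤ c * (∑ i, x i)^2 + t * (x ⬝ᵥ x) - x ⬝ᵥ A *ᵥ x)
    (x : Fin N → ℝ) (hx : ∑ i, x i = 0) (hq : t * (x ⬝ᵥ x) = x ⬝ᵥ A *ᵥ x) :
    A *ᵥ x = t • x := by
  set y := A *ᵥ x - t • x with hy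
  have hsym : x ⬝ᵥ A *ᵥ y = y ⬝ᵥ A *ᵥ x := by
    rw [dotProduct_mulVec, ← mulVec_transpose, hs, dotProduct_comm]
  have hL : y ⬝ᵥ y = y ⬝ᵥ A *ᵥ x - t * (x ⬝ᵥ y) := by
    conv_lhs => rw [hy, ← hy, hy]
    rw [← hy, dotProduct_comm x y]
    conv_lhs => arg 2; rw [hy]
    rw [dotProduct_sub, dotProduct_smul, smul_eq_mul]
  have key : ∀ e : ℝ, 0 ≤ e^2 * (c * (∑ i, y i)^2 + t * (y ⬝ᵥ y) - y ⬝ᵥ A *ᵥ y)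
      - 2 * e * (y ⬝ᵥ y) := by
    intro e
    have h1 := h (x + e • y)
    have h2 : ∑ i, (x + e • y) i = e * ∑ i, y i := by
      simp [Finset.sum_add_distrib, hx, Finset.mul_sum]
    rw [h2] at h1
    simp only [mulVec_add, mulVec_smul, dotProduct_add, add_dotProduct, smul_dotProduct,
      dotProduct_smul, smul_eq_mul, dotProduct_comm y x, hsym] at h1
    rw [hL] at h1 ⊢
    linear_combination h1 + hq
  set F := c * (∑ i, y i)^2 + t * (y ⬝ᵥ y) - y ⬝ᵥ A *ᵥ y
  have hF : 0 ≤ F := h y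
  by_contra hne
  have hy0 : y ≠ 0 := fun h0 => hne (sub_eq_zero.1 h0)
  have hp := dot_self_pos hy0
  set L := y ⬝ᵥ y
  have := key (L / (F+1))
  have e : (L / (F+1))^2 * F - 2 * (L / (F+1)) * L = - (L^2 * (F+2) / (F+1)^2) := by
    field_simp; ring
  rw [e] at this
  have : 0 < L^2 * (F+2) / (F+1)^2 := by positivity
  linarith

lemma exists_eigvecs {N : ℕ} (A : Matrix (Fin N) (Fin N) ℝ) (hA : A.IsHermitian)
    (μ : Fin N → ℝ) (hperm : ∃ σ : Equiv.Perm (Fin N), μ = hA.eigenvalues ∘ σ) :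
    ∃ v : Fin N → Fin N → ℝ, (∀ i, A *ᵥ v i = μ i • v i) ∧
      (∀ i j, v i ⬝ᵥ v j = if i = j then 1 else 0) := by
  obtain ⟨σ, rfl⟩ := hperm
  refine ⟨fun i => hA.eigenvectorBasis (σ i), fun i => hA.mulVec_eigenvectorBasis _, ?_⟩
  intro i j
  have := orthonormal_iff_ite.1 hA.eigenvectorBasis.orthonormal (σ j) (σ i)
  simp only [EuclideanSpace.inner_eq_star_dotProduct, σ.injective.eq_iff] at this
  simpa [eq_comm] using this

/-- quadratic form is bounded by the top eigenvalue -/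
lemma quad_le {N : ℕ} (A : Matrix (Fin N) (Fin N) ℝ) (hA : A.IsHermitian) (t : ℝ)
    (ht : ∀ i, hA.eigenvalues i ≤ t) (x : Fin N → ℝ) : x ⬝ᵥ A *ᵥ x ≤ t * (x ⬝ᵥ x) := by
  have hsub : (t • (1 : Matrix (Fin N) (Fin N) ℝ) - A).PosSemidef := by
    have h2 := hA.spectral_theorem
    rw [Unitary.conjStarAlgAut_apply] at h2
    have e : t • (1 : Matrix (Fin N) (Fin N) ℝ) - A =
        (hA.eigenvectorUnitary : Matrix (Fin N) (Fin N) ℝ) *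
          diagonal (fun i => t - hA.eigenvalues i) *
          star (hA.eigenvectorUnitary : Matrix (Fin N) (Fin N) ℝ) := by
      have e : diagonal (fun i => t - hA.eigenvalues i)
          = t • (1 : Matrix (Fin N) (Fin N) ℝ) - diagonal (RCLike.ofReal ∘ hA.eigenvalues) := by
        ext i j
        by_cases h : i = j
        · subst h; simp
        · simp [h]
      rw [e, Matrix.mul_sub, Matrix.sub_mul, ← h2]
      simp
    rw [e, star_eq_conjTranspose]
    exact (PosSemidef.diagonal (fun i => sub_nonneg.2 (ht i))).mul_mul_conjTranspose_same _
  have := hsub.dotProduct_mulVec_nonneg x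
  simp [Matrix.sub_mulVec, Matrix.smul_mulVec] at this
  linarith

/-- Perron-type lemma: the absolute value of a top eigenvector is again one. -/
lemma perron {N : ℕ} (A : Matrix (Fin N) (Fin N) ℝ) (hA : A.IsHermitian) (hs : Aᵀ = A)
    (hnn : ∀ i j, 0 ≤ A i j) (t : ℝ)
    (ht : ∀ i, hA.eigenvalues i ≤ t) (x : Fin N → ℝ) (hx : x ≠ 0) (hxe : A *ᵥ x = t • x) :
    A *ᵥ (fun i => |x i|) = t • (fun i => |x i|) ∧ 0 < ∑ i, |x i| := by
  refine ⟨?_, ?_⟩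
  · set w : Fin N → ℝ := fun i => |x i|
    have hw : w ⬝ᵥ w = x ⬝ᵥ x := by simp [w, dotProduct]
    have h1 : x ⬝ᵥ A *ᵥ x ≤ w ⬝ᵥ A *ᵥ w := by
      simp only [dotProduct, mulVec, Finset.mul_sum]
      refine Finset.sum_le_sum fun i _ => Finset.sum_le_sum fun j _ => ?_
      have : x i * x j ≤ |x i| * |x j| := by rw [← abs_mul]; exact le_abs_self _
      have := mul_le_mul_of_nonneg_left this (hnn i j)
      simp only [w]; linarith
    have h2 := quad_le A hA t ht w
    have h3 : x ⬝ᵥ A *ᵥ x = t * (x ⬝ᵥ x) := by rw [hxe]; simp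
    have h4 : t * (w ⬝ᵥ w) = w ⬝ᵥ A *ᵥ w := by
      apply le_antisymm _ h2; rw [hw, ← h3]; exact h1
    -- eigenvector from equality
    have hps : (t • (1 : Matrix (Fin N) (Fin N) ℝ) - A).PosSemidef := by
      refine PosSemidef.of_dotProduct_mulVec_nonneg ?_ ?_
      · rw [IsHermitian, conjTranspose_eq_transpose_of_trivial]
        simp [hs]
      · intro y
        have := quad_le A hA t ht y
        simp [Matrix.sub_mulVec, Matrix.smul_mulVec]
        linarith
    have h5 := (hps.dotProduct_mulVec_zero_iff w).1 (by
      simp [Matrix.sub_mulVec, Matrix.smul_mulVec]; linarith)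
    simp only [Matrix.sub_mulVec, Matrix.smul_mulVec, one_mulVec, sub_eq_zero] at h5
    exact h5.symm
  · obtain ⟨i, hi⟩ := Function.ne_iff.1 hx
    exact Finset.sum_pos' (fun i _ => abs_nonneg _) ⟨i, Finset.mem_univ _, abs_pos.2 hi⟩

lemma finrank_inf_onePerp_add_one {N : ℕ} (E : Submodule ℝ (Fin N → ℝ)) (w : Fin N → ℝ)
    (hw : w ∈ E) (hS : ∑ i, w i ≠ 0) :
    Module.finrank ℝ (E ⊓ onePerp N : Submodule ℝ (Fin N → ℝ)) + 1 = Module.finrank ℝ E := by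
  set S : (Fin N → ℝ) →ₗ[ℝ] ℝ := ∑ i : Fin N, LinearMap.proj i
  have h0 : S.domRestrict E ≠ 0 := by
    intro h
    have := LinearMap.congr_fun h ⟨w, hw⟩
    apply hS
    simpa [S] using this
  rw [← Module.Dual.finrank_ker_add_one_of_ne_zero h0]
  congr 1
  have : E ⊓ onePerp N = (LinearMap.ker (S.domRestrict E)).map E.subtype := by
    rw [LinearMap.ker_domRestrict, Submodule.map_comap_subtype]; rfl
  rw [this, Submodule.finrank_map_subtype_eq]

lemma finrank_onePerp (d : ℕ) : Module.finrank ℝ (onePerp (d+2)) = d + 1 := by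
  have h := finrank_inf_onePerp_add_one (⊤ : Submodule ℝ (Fin (d+2) → ℝ)) (Pi.single 0 1) trivial
    (by simp)
  rw [top_inf_eq, finrank_top, Module.finrank_fin_fun] at h
  omega

lemma la_main (d : ℕ) (A : Matrix (Fin (d+2)) (Fin (d+2)) ℝ) (hA : A.IsHermitian) (hs : Aᵀ = A)
    (hnn : ∀ i j, 0 ≤ A i j)
    (μ : Fin (d+2) → ℝ) (hmono : Antitone μ)
    (hperm : ∃ σ : Equiv.Perm (Fin (d+2)), μ = hA.eigenvalues ∘ σ) (c t : ℝ)
    (h : ∀ x : Fin (d+2) → ℝ, 0 ≤ c * (∑ i, x i)^2 + t * (x ⬝ᵥ x) - x ⬝ᵥ A *ᵥ x)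
    (x : Fin (d+2) → ℝ) (hx0 : x ≠ 0) (hx : ∑ i, x i = 0) (hq : t * (x ⬝ᵥ x) = x ⬝ᵥ A *ᵥ x) :
    Module.finrank ℝ (eigK A t ⊓ onePerp (d+2) : Submodule ℝ (Fin (d+2) → ℝ)) =
      (Finset.univ.filter fun i => μ i = μ 1).card - (if μ 0 = μ 1 then 1 else 0) := by
  have hxe := psd_eig A hs c t h x hx hq
  have hcard : ∀ s, (Finset.univ.filter fun i => μ i = s).card = Module.finrank ℝ (eigK A s) := by
    intro s
    rw [finrank_eigK A hA s]
    obtain ⟨σ, rfl⟩ := hperm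
    refine Finset.card_bij (fun i _ => σ i) ?_ ?_ ?_
    · intro i hi; simpa using hi
    · intro i _ j _ hij; exact σ.injective hij
    · intro j hj; exact ⟨σ.symm j, by simpa using hj, by simp⟩
  have hle : ∀ s, μ 0 ≤ s → ∀ i, hA.eigenvalues i ≤ s := by
    intro s hs i
    obtain ⟨σ, hσ⟩ := hperm
    have : hA.eigenvalues i = μ (σ.symm i) := by rw [hσ]; simp
    rw [this]
    exact (hmono (Fin.zero_le _)).trans hs
  have h01 : μ 1 ≤ μ 0 := hmono (Fin.zero_le _)
  obtain ⟨v, hv, hvo⟩ := exists_eigvecs A hA μ hperm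
  have hne : (0 : Fin (d+2)) ≠ 1 := by simp
  -- μ 1 ≤ t
  have hup : μ 1 ≤ t := by
    by_contra hlt
    push Not at hlt
    obtain ⟨a, b, hab, hS⟩ : ∃ a b : ℝ, (0 < a^2 + b^2) ∧
        a * (∑ i, v 0 i) + b * (∑ i, v 1 i) = 0 := by
      by_cases hz : ∑ i, v 0 i = 0
      · exact ⟨1, 0, by norm_num, by simp [hz]⟩
      · exact ⟨∑ i, v 1 i, -∑ i, v 0 i, by
          have : 0 < (∑ i, v 0 i)^2 := by positivity
          nlinarith [sq_nonneg (∑ i, v 1 i)], by ring⟩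
    have h1 := h (a • v 0 + b • v 1)
    have h2 : ∑ i, (a • v 0 + b • v 1) i = 0 := by
      simp only [Pi.add_apply, Pi.smul_apply, smul_eq_mul, Finset.sum_add_distrib,
        ← Finset.mul_sum, hS]
    rw [h2] at h1
    simp only [mulVec_add, mulVec_smul, dotProduct_add, add_dotProduct, smul_dotProduct,
      dotProduct_smul, smul_eq_mul, hv, hvo, if_true, if_neg hne, if_neg hne.symm] at h1
    nlinarith [sq_nonneg a, sq_nonneg b]
  have hteq : t = μ 1 := by
    apply le_antisymm _ hup
    have hpos : 0 < Module.finrank ℝ (eigK A t) := by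
      rw [Module.finrank_pos_iff_exists_ne_zero]
      exact ⟨⟨x, (mem_eigK _ _ _).2 hxe⟩, by simpa [Subtype.ext_iff] using hx0⟩
    rw [← hcard] at hpos
    obtain ⟨i, hi⟩ := Finset.card_pos.1 hpos
    simp only [Finset.mem_filter, Finset.mem_univ, true_and] at hi
    have hge : ∀ j : Fin (d+2), j ≠ 0 → μ j ≤ μ 1 := by
      intro j hj
      apply hmono
      rw [Fin.le_def]
      have : (j : ℕ) ≠ 0 := fun h => hj (Fin.ext h)
      simp; omega
    by_cases hi0 : i = 0
    · subst hi0
      obtain ⟨hp1, hp2⟩ := perron A hA hs hnn t (hle t hi.le) x hx0 hxe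
      have hd := finrank_inf_onePerp_add_one (eigK A t) _ ((mem_eigK _ _ _).2 hp1) hp2.ne'
      have hpos' : 0 < Module.finrank ℝ
          (eigK A t ⊓ onePerp (d+2) : Submodule ℝ (Fin (d+2) → ℝ)) := by
        rw [Module.finrank_pos_iff_exists_ne_zero]
        exact ⟨⟨x, (mem_eigK _ _ _).2 hxe, (mem_onePerp _).2 hx⟩,
          by simpa [Subtype.ext_iff] using hx0⟩
      have h2 : 1 < (Finset.univ.filter fun i => μ i = t).card := by rw [hcard]; omega
      obtain ⟨j, hj, hj0⟩ := Finset.exists_mem_ne h2 0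
      simp only [Finset.mem_filter, Finset.mem_univ, true_and] at hj
      rw [← hj]; exact hge j hj0
    · rw [← hi]; exact hge i hi0
  rw [← hteq, hcard]
  by_cases h0 : μ 0 = t
  · obtain ⟨hp1, hp2⟩ := perron A hA hs hnn t (hle t h0.le) x hx0 hxe
    have hd := finrank_inf_onePerp_add_one (eigK A t) _ ((mem_eigK _ _ _).2 hp1) hp2.ne'
    rw [if_pos h0]; omega
  · rw [if_neg h0, Nat.sub_zero]
    have hlt : t < μ 0 := lt_of_le_of_ne (hteq ▸ h01) (Ne.symm h0)
    rw [show (eigK A t ⊓ onePerp (d+2)) = eigK A t from inf_eq_left.2 ?_]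
    intro y hy
    rw [mem_eigK] at hy
    rw [mem_onePerp]
    have hv0 := h (v 0)
    rw [hv, dotProduct_smul, hvo, if_pos rfl, smul_eq_mul] at hv0
    have hvS : ∑ i, v 0 i ≠ 0 := by
      intro hz; rw [hz] at hv0; linarith
    have horth : y ⬝ᵥ v 0 = 0 := by
      have e1 : y ⬝ᵥ A *ᵥ v 0 = (A *ᵥ y) ⬝ᵥ v 0 := by
        rw [dotProduct_mulVec, ← mulVec_transpose, hs]
      rw [hv, hy, dotProduct_smul, smul_dotProduct, smul_eq_mul, smul_eq_mul] at e1
      have : (μ 0 - t) * (y ⬝ᵥ v 0) = 0 := by linarith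
      rcases mul_eq_zero.1 this with h | h
      · linarith
      · exact h
    set a := -(∑ i, y i) / ∑ i, v 0 i with ha
    have h1 := h (y + a • v 0)
    have h2 : ∑ i, (y + a • v 0) i = 0 := by
      simp only [Pi.add_apply, Pi.smul_apply, smul_eq_mul, Finset.sum_add_distrib,
        ← Finset.mul_sum, ha]
      field_simp; ring
    rw [h2] at h1
    simp only [mulVec_add, mulVec_smul, dotProduct_add, add_dotProduct, smul_dotProduct,
      dotProduct_smul, smul_eq_mul, hv, hvo, if_true, hy, horth, dotProduct_comm (v 0) y] at h1
    have h3 : 0 ≤ (t - μ 0) * a^2 := by nlinarith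
    have h4 : a = 0 := by
      by_contra hne0
      have : 0 < a^2 := by positivity
      nlinarith
    rw [ha, div_eq_zero_iff] at h4
    rcases h4 with h4 | h4
    · linarith
    · exact absurd h4 hvS

lemma dist_quad {N e : ℕ} (G : SimpleGraph (Fin N)) [DecidableRel G.Adj]
    (p : Fin N → EuclideanSpace ℝ (Fin e)) (a b : ℝ)
    (h1 : ∀ i j, G.Adj i j → dist (p i) (p j) = a)
    (h2 : ∀ i j, i ≠ j → ¬ G.Adj i j → dist (p i) (p j) = b) (x : Fin N → ℝ) :
    ∑ i, ∑ j, x i * x j * (dist (p i) (p j) * dist (p i) (p j)) =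
      b^2 * (∑ i, x i)^2 - b^2 * (x ⬝ᵥ x) + (a^2 - b^2) * (x ⬝ᵥ (G.adjMatrix ℝ) *ᵥ x) := by
  have e1 : ∀ i j, x i * x j * (dist (p i) (p j) * dist (p i) (p j)) =
      b^2 * (x i * x j) - b^2 * (if i = j then x i * x j else 0)
        + (a^2-b^2) * (x i * (G.adjMatrix ℝ i j * x j)) := by
    intro i j
    by_cases hij : i = j
    · subst hij; simp
    · by_cases hadj : G.Adj i j
      · simp [hij, hadj, h1 i j hadj]; ring
      · simp [hij, hadj, h2 i j hij hadj]; ring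
  simp only [e1, Finset.sum_add_distrib, Finset.sum_sub_distrib, ← Finset.mul_sum]
  simp only [dotProduct, mulVec, Finset.sum_ite_eq, Finset.mem_univ, if_true, sq (∑ i, x i),
    Finset.sum_mul_sum]
  simp only [Finset.mul_sum]

lemma norm_quad {N e : ℕ} (G : SimpleGraph (Fin N)) [DecidableRel G.Adj]
    (p : Fin N → EuclideanSpace ℝ (Fin e)) (a b : ℝ)
    (h1 : ∀ i j, G.Adj i j → dist (p i) (p j) = a)
    (h2 : ∀ i j, i ≠ j → ¬ G.Adj i j → dist (p i) (p j) = b) (x : Fin N → ℝ)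
    (hx : ∑ i, x i = 0) :
    ‖∑ i, x i • p i‖^2 = (b^2 * (x ⬝ᵥ x) - (a^2 - b^2) * (x ⬝ᵥ (G.adjMatrix ℝ) *ᵥ x)) / 2 := by
  rw [← real_inner_self_eq_norm_sq, inner_sum_smul_sum_smul_of_sum_eq_zero p hx p hx]
  simp only [← dist_eq_norm]
  rw [dist_quad G p a b h1 h2, hx]
  ring

lemma sphere_quad {N e : ℕ} (G : SimpleGraph (Fin N)) [DecidableRel G.Adj]
    (p : Fin N → EuclideanSpace ℝ (Fin e)) (a b : ℝ)
    (h1 : ∀ i j, G.Adj i j → dist (p i) (p j) = a)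
    (h2 : ∀ i j, i ≠ j → ¬ G.Adj i j → dist (p i) (p j) = b)
    (o : EuclideanSpace ℝ (Fin e)) (r : ℝ) (ho : ∀ i, dist (p i) o = r) (x : Fin N → ℝ) :
    0 ≤ (r^2 - b^2/2) * (∑ i, x i)^2 +
      (b^2 * (x ⬝ᵥ x) - (a^2 - b^2) * (x ⬝ᵥ (G.adjMatrix ℝ) *ᵥ x)) / 2 := by
  have h0 : 0 ≤ inner ℝ (∑ i, x i • (p i - o)) (∑ i, x i • (p i - o)) := real_inner_self_nonneg
  have e1 : ∀ i j, x i * (x j * inner ℝ (p i - o) (p j - o)) =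
      r^2 * (x i * x j) - (1/2) * (x i * x j * (dist (p i) (p j) * dist (p i) (p j))) := by
    intro i j
    rw [real_inner_eq_norm_mul_self_add_norm_mul_self_sub_norm_sub_mul_self_div_two,
      sub_sub_sub_cancel_right, ← dist_eq_norm, ← dist_eq_norm, ← dist_eq_norm, ho, ho]
    ring
  simp_rw [sum_inner, inner_sum, real_inner_smul_left, real_inner_smul_right, e1,
    Finset.sum_sub_distrib, ← Finset.mul_sum] at h0
  rw [dist_quad G p a b h1 h2] at h0
  rw [← Finset.sum_mul, ← sq] at h0
  linarith

/-- The linear map `x ↦ ∑ x i • p i`. -/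
def combMap {N e : ℕ} (p : Fin N → EuclideanSpace ℝ (Fin e)) :
    (Fin N → ℝ) →ₗ[ℝ] EuclideanSpace ℝ (Fin e) := Fintype.linearCombination ℝ p

lemma combMap_apply {N e : ℕ} (p : Fin N → EuclideanSpace ℝ (Fin e)) (x : Fin N → ℝ) :
    combMap p x = ∑ i, x i • p i := by
  simp [combMap, Fintype.linearCombination_apply]

lemma rank_null {d e : ℕ} (p : Fin (d+2) → EuclideanSpace ℝ (Fin e)) :
    Module.finrank ℝ ((onePerp (d+2)).map (combMap p)) +
    Module.finrank ℝ (onePerp (d+2) ⊓ LinearMap.ker (combMap p) :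
      Submodule ℝ (Fin (d+2) → ℝ)) = d + 1 := by
  have h := LinearMap.finrank_range_add_finrank_ker ((combMap p).domRestrict (onePerp (d+2)))
  rw [finrank_onePerp, LinearMap.range_domRestrict] at h
  rw [← h, ← Submodule.map_comap_subtype, Submodule.finrank_map_subtype_eq,
    LinearMap.ker_domRestrict]

lemma exists_isometry {d n : ℕ} (V : Submodule ℝ (EuclideanSpace ℝ (Fin d)))
    (hV : Module.finrank ℝ V ≤ n) : Nonempty (V →ₗᵢ[ℝ] EuclideanSpace ℝ (Fin n)) := by
  let b := stdOrthonormalBasis ℝ V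
  let f : V →ₗ[ℝ] EuclideanSpace ℝ (Fin n) := b.toBasis.constr ℝ
    (fun i => EuclideanSpace.basisFun (Fin n) ℝ (Fin.castLE hV i))
  refine ⟨f.isometryOfOrthonormal (v := b.toBasis) (by simpa using b.orthonormal) ?_⟩
  have : ⇑f ∘ ⇑b.toBasis = (EuclideanSpace.basisFun (Fin n) ℝ) ∘ (Fin.castLE hV) := by
    funext i; simp [f, Module.Basis.constr_apply_fintype]
  rw [this]
  exact (EuclideanSpace.basisFun (Fin n) ℝ).orthonormal.comp _ (Fin.castLE_injective hV)

lemma reduce_dim {d n : ℕ} (G : SimpleGraph (Fin (d+2))) (k : ℝ)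
    (p : Fin (d+2) → EuclideanSpace ℝ (Fin d)) (o : EuclideanSpace ℝ (Fin d)) (r : ℝ)
    (hp : IsTwoDistRep (d+2) d G k p) (ho : ∀ i, dist (p i) o = r)
    (hV : Module.finrank ℝ ((onePerp (d+2)).map (combMap p)) ≤ n) :
    SphericalWith (d+2) n G k := by
  set V := (onePerp (d+2)).map (combMap p)
  obtain ⟨φ⟩ := exists_isometry V hV
  have hmem : ∀ i, p i - p 0 ∈ V := by
    intro i
    refine ⟨Pi.single i 1 - Pi.single 0 1, ?_, ?_⟩
    · rw [SetLike.mem_coe, mem_onePerp]; simp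
    · rw [map_sub, combMap_apply, combMap_apply]; simp [Pi.single_apply]
  set w := o - p 0
  let q : Fin (d+2) → EuclideanSpace ℝ (Fin n) := fun i => φ ⟨p i - p 0, hmem i⟩
  have hq : ∀ i j, dist (q i) (q j) = dist (p i) (p j) := by
    intro i j
    simp only [q]
    rw [φ.isometry.dist_eq, Subtype.dist_eq, dist_sub_right]
  obtain ⟨u, huV, hu⟩ : ∃ u ∈ V, ∀ v ∈ V, inner ℝ (w - u) v = 0 :=
    ⟨V.starProjection w, V.starProjection_apply_mem w, V.starProjection_inner_eq_zero w⟩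
  refine ⟨q, φ ⟨u, huV⟩, √(r^2 - ‖w - u‖^2), ?_, ?_⟩
  · obtain ⟨a, b, h1, h2, h3, h4, h5, h6, h7⟩ := hp
    exact ⟨a, b, h1, h2, h3, fun i j h => (hq i j).trans (h4 i j h),
      fun i j h h' => (hq i j).trans (h5 i j h h'), h6, h7⟩
  · intro i
    simp only [q]
    rw [φ.isometry.dist_eq, Subtype.dist_eq, dist_eq_norm]
    have horth := hu (p i - p 0 - u) (V.sub_mem (hmem i) huV)
    have hpyth : ‖p i - o‖^2 = ‖p i - p 0 - u‖^2 + ‖w - u‖^2 := by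
      have e : p i - o = (p i - p 0 - u) - (w - u) := by simp [w]
      rw [e, norm_sub_sq_real, real_inner_comm, horth]; ring
    rw [← dist_eq_norm (p i) o, ho i] at hpyth
    rw [hpyth, add_sub_cancel_right, Real.sqrt_sq (norm_nonneg _)]

lemma rep_ker {d e : ℕ} (G : SimpleGraph (Fin (d+2))) [DecidableRel G.Adj]
    (p : Fin (d+2) → EuclideanSpace ℝ (Fin e)) (a b : ℝ) (hab : b < a) (hb : 0 < b)
    (h1 : ∀ i j, G.Adj i j → dist (p i) (p j) = a)
    (h2 : ∀ i j, i ≠ j → ¬ G.Adj i j → dist (p i) (p j) = b) (x : Fin (d+2) → ℝ)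
    (hx : ∑ i, x i = 0) :
    x ⬝ᵥ (G.adjMatrix ℝ) *ᵥ x ≤ (b^2/(a^2-b^2)) * (x ⬝ᵥ x) ∧
    (combMap p x = 0 ↔ (b^2/(a^2-b^2)) * (x ⬝ᵥ x) = x ⬝ᵥ (G.adjMatrix ℝ) *ᵥ x) := by
  have hpos : 0 < a^2 - b^2 := by nlinarith
  have hn := norm_quad G p a b h1 h2 x hx
  rw [← combMap_apply] at hn
  have e : (b^2/(a^2-b^2)) * (x ⬝ᵥ x) - x ⬝ᵥ (G.adjMatrix ℝ) *ᵥ x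
      = 2 / (a^2-b^2) * ‖combMap p x‖^2 := by
    rw [hn]; field_simp
  constructor
  · have : 0 ≤ 2 / (a^2-b^2) * ‖combMap p x‖^2 := by positivity
    linarith
  · rw [← sub_eq_zero (b := x ⬝ᵥ (G.adjMatrix ℝ) *ᵥ x), e]
    simp [hpos.ne']

lemma exists_ker {d e : ℕ} (hed : e ≤ d) (p : Fin (d+2) → EuclideanSpace ℝ (Fin e)) :
    d + 1 - e ≤ Module.finrank ℝ (onePerp (d+2) ⊓ LinearMap.ker (combMap p) :
      Submodule ℝ (Fin (d+2) → ℝ)) ∧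
    ∃ x : Fin (d+2) → ℝ, x ≠ 0 ∧ ∑ i, x i = 0 ∧ combMap p x = 0 := by
  have h := rank_null p
  have h2 := Submodule.finrank_le ((onePerp (d+2)).map (combMap p))
  rw [finrank_euclideanSpace_fin] at h2
  refine ⟨by omega, ?_⟩
  have h3 : 0 < Module.finrank ℝ (onePerp (d+2) ⊓ LinearMap.ker (combMap p) :
      Submodule ℝ (Fin (d+2) → ℝ)) := by omega
  rw [Module.finrank_pos_iff_exists_ne_zero] at h3
  obtain ⟨⟨x, hx1, hx2⟩, hx0⟩ := h3
  exact ⟨x, by simpa [Subtype.ext_iff] using hx0, (mem_onePerp _).1 hx1, hx2⟩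

/-- **Proposition 2.** If `G` on `d+2` vertices is spherically representable in
`ℝ^d`, then for `0 < n ≤ d`, `G` is (spherically) representable in `ℝ^n` iff the
multiplicity of `λ₂` in `A_G` (diminished by one if `λ₁ = λ₂`) is at least
`d+1-n`. -/
theorem stmt1 (n d : ℕ) (hn : 0 < n) (hnd : n ≤ d)
    (G : SimpleGraph (Fin (d+2))) [DecidableRel G.Adj]
    (hG : Spherical (d+2) d G)
    (hA : (G.adjMatrix ℝ).IsHermitian)
    (μ : Fin (d+2) → ℝ) (hmono : Antitone μ)
    (hperm : ∃ σ : Equiv.Perm (Fin (d+2)), μ = hA.eigenvalues ∘ σ)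
    (m : ℕ)
    (hm : m = (Finset.univ.filter fun i => μ i = μ 1).card
        - (if μ 0 = μ 1 then 1 else 0)) :
    ((∃ k : ℝ, RepresentableWith (d+2) n G k) ↔ d + 1 - n ≤ m) ∧
    (Spherical (d+2) n G ↔ d + 1 - n ≤ m) := by
  obtain ⟨k, p, o, r, hp, ho⟩ := hG
  obtain ⟨a, b, hab, hb, hk, h1, h2, h3, h4⟩ := id hp
  have hpos : 0 < a^2 - b^2 := by nlinarith
  set A := G.adjMatrix ℝ with hAdef
  have hs : Aᵀ = A := G.transpose_adjMatrix
  have hnn : ∀ i j, 0 ≤ A i j := by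
    intro i j
    rw [hAdef, SimpleGraph.adjMatrix_apply]
    split_ifs <;> norm_num
  set t := b^2/(a^2-b^2) with ht
  have hform : ∀ x : Fin (d+2) → ℝ,
      0 ≤ (2 * (r^2 - b^2/2) / (a^2-b^2)) * (∑ i, x i)^2 + t * (x ⬝ᵥ x) - x ⬝ᵥ A *ᵥ x := by
    intro x
    have hq := sphere_quad G p a b h1 h2 o r ho x
    have e : (2 * (r^2 - b^2/2) / (a^2-b^2)) * (∑ i, x i)^2 + t * (x ⬝ᵥ x) - x ⬝ᵥ A *ᵥ x
        = 2 / (a^2-b^2) * ((r^2 - b^2/2) * (∑ i, x i)^2 +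
          (b^2 * (x ⬝ᵥ x) - (a^2 - b^2) * (x ⬝ᵥ A *ᵥ x)) / 2) := by
      rw [ht]; field_simp; ring
    rw [e]
    positivity
  obtain ⟨-, x₀, hx0, hxS, hxT⟩ := exists_ker le_rfl p
  have hker := rep_ker G p a b hab hb h1 h2
  have hmain := la_main d A hA hs hnn μ hmono hperm _ t hform x₀ hx0 hxS
    ((hker x₀ hxS).2.1 hxT)
  rw [← hm] at hmain
  have hK : eigK A t ⊓ onePerp (d+2) = onePerp (d+2) ⊓ LinearMap.ker (combMap p) := by
    ext x
    rw [Submodule.mem_inf, Submodule.mem_inf, mem_eigK, mem_onePerp, LinearMap.mem_ker]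
    constructor
    · rintro ⟨h, hx⟩
      refine ⟨hx, (hker x hx).2.2 ?_⟩
      rw [← hAdef, h]; simp [ht]
    · rintro ⟨hx, h⟩
      exact ⟨psd_eig A hs _ t hform x hx ((hker x hx).2.1 h), hx⟩
  have hback : d + 1 - n ≤ m → Spherical (d+2) n G := by
    intro hle
    refine ⟨k, reduce_dim G k p o r hp ho ?_⟩
    have hr := rank_null p
    rw [← hK, hmain] at hr
    omega
  have hforw : (∃ k : ℝ, RepresentableWith (d+2) n G k) → d + 1 - n ≤ m := by
    rintro ⟨k', q, a', b', hab', hb', -, h1', h2', -, -⟩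
    have hker' := rep_ker G q a' b' hab' hb' h1' h2'
    obtain ⟨hdim, y, hy0, hyS, hyT⟩ := exists_ker hnd q
    have htt : b'^2/(a'^2-b'^2) = t := by
      apply le_antisymm
      · have e1 := (hker' y hyS).2.1 hyT
        have e2 := (hker y hyS).1
        rw [← e1] at e2
        exact le_of_mul_le_mul_right e2 (dot_self_pos hy0)
      · have e1 := (hker x₀ hxS).2.1 hxT
        have e2 := (hker' x₀ hxS).1
        rw [← e1] at e2
        exact le_of_mul_le_mul_right e2 (dot_self_pos hx0)
    have hKK : onePerp (d+2) ⊓ LinearMap.ker (combMap q)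
        = onePerp (d+2) ⊓ LinearMap.ker (combMap p) := by
      ext x
      rw [Submodule.mem_inf, Submodule.mem_inf, mem_onePerp, LinearMap.mem_ker, LinearMap.mem_ker]
      refine and_congr_right fun hx => ?_
      rw [(hker x hx).2, (hker' x hx).2, htt]
    rw [hKK, ← hK, hmain] at hdim
    exact hdim
  have hsr : Spherical (d+2) n G → ∃ k : ℝ, RepresentableWith (d+2) n G k := by
    rintro ⟨k', q, _, _, hq, -⟩
    exact ⟨k', q, hq⟩
  exact ⟨⟨hforw, fun h => hsr (hback h)⟩, ⟨fun h => hforw (hsr h), hback⟩⟩
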